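/- arXiv:2009.03773 — 4 statements merged into one kernel-verified Lean document; each statement's English description precedes it below -/
import Mathlib

section
/- For every t ≥ 0 one has G_l(t)² ≥ t · F_l(t), with equality for t ≥ 1/l. -/
open Set

/-- For `β > 1`, `l ≥ 1` and the truncated functions `F_l`, `G_l`, one has
`G_l(t)² ≥ t·F_l(t)` for every `t ≥ 0`, with equality for `t ≥ 1/l`. -/
theorem truncation_G_sq_ge_t_mul_F
    (β : ℝ) (hβ : 1 < β) (l : ℕ) (hl : 1 ≤ l)
    (F G : ℝ → ℝ)
    (hF : ∀ t : ℝ, F t = if t ≤ 1 / (l : ℝ)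
        then -β * (l : ℝ) ^ (β + 1) * (t - (β + 1) / ((l : ℝ) * β))
        else t ^ (-β))
    (hG : ∀ t : ℝ, G t = if t ≤ 1 / (l : ℝ)
        then (1 - β) / 2 * (l : ℝ) ^ ((β + 1) / 2) * (t + (β + 1) / ((l : ℝ) * (1 - β)))
        else t ^ ((1 - β) / 2)) :
    (∀ t : ℝ, 0 ≤ t → t * F t ≤ (G t) ^ 2) ∧
    (∀ t : ℝ, 1 / (l : ℝ) ≤ t → (G t) ^ 2 = t * F t) := by
  have hl0 : (0 : ℝ) < (l : ℝ) := by exact_mod_cast hl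
  have hP : ((l : ℝ) ^ ((β + 1) / 2)) ^ 2 = (l : ℝ) ^ (β + 1) := by
    rw [← Real.rpow_natCast, ← Real.rpow_mul hl0.le]
    congr 1
    push_cast
    ring
  have hPpos : 0 < (l : ℝ) ^ (β + 1) := Real.rpow_pos_of_pos hl0 _
  have h1 : ∀ t : ℝ, t ≤ 1 / (l : ℝ) →
      (G t) ^ 2 - t * F t = (l : ℝ) ^ (β + 1) * ((β + 1) / 2 * (t - 1 / (l : ℝ))) ^ 2 := by
    intro t ht
    have hb : (1 - β) ≠ 0 := by linarith
    have hb' : β ≠ 0 := by linarith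
    have hl' := hl0.ne'
    rw [hF, hG, if_pos ht, if_pos ht, mul_pow, mul_pow, hP]
    generalize (l : ℝ) ^ (β + 1) = P
    field_simp
    ring
  have h2 : ∀ t : ℝ, 1 / (l : ℝ) < t → (G t) ^ 2 = t * F t := by
    intro t ht
    have ht0 : 0 < t := lt_trans (by positivity) ht
    rw [hF, hG, if_neg (not_le.mpr ht), if_neg (not_le.mpr ht), ← Real.rpow_natCast,
      ← Real.rpow_mul ht0.le, ← Real.rpow_one_add' ht0.le (by linarith)]
    congr 1
    push_cast
    ring
  refine ⟨fun t _ => ?_, fun t ht => ?_⟩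
  · rcases le_or_gt t (1 / (l : ℝ)) with h | h
    · have h3 := h1 t h
      have h4 : 0 ≤ (l : ℝ) ^ (β + 1) * ((β + 1) / 2 * (t - 1 / (l : ℝ))) ^ 2 := by positivity
      linarith
    · exact (h2 t h).ge
  · rcases ht.eq_or_lt with h | h
    · have h3 := h1 t h.ge
      rw [← h] at h3 ⊢
      simp only [sub_self, mul_zero, ne_eq, OfNat.ofNat_ne_zero, not_false_eq_true, zero_pow] at h3
      linarith
    · exact h2 t h
end

section
/- For every t > 0 one has G_l'(t)² = ((β−1)²/(4β)) · |F_l'(t)|, where F_l' and G_l' denote the derivatives of F_l and G_l (which exist at every t > 0, the one-sided derivatives at t = 1/l coinciding). -/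
open Set

theorem trunc_aux (p a m c : ℝ) (ha : 0 < a) (f : ℝ → ℝ)
    (hf : ∀ t : ℝ, f t = if t ≤ a then m * (t + c) else t ^ p)
    (hm : m = p * a ^ (p - 1)) (hc : m * (a + c) = a ^ p) (t : ℝ) :
    HasDerivAt f (p * (max t a) ^ (p - 1)) t := by
  have hlin : ∀ x : ℝ, HasDerivAt (fun t : ℝ => m * (t + c)) m x := by
    intro x
    simpa using ((hasDerivAt_id x).add_const c).const_mul m
  have hpow : ∀ x : ℝ, 0 < x → HasDerivAt (fun t : ℝ => t ^ p) (p * x ^ (p - 1)) x := by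
    intro x hx
    exact Real.hasDerivAt_rpow_const (Or.inl hx.ne')
  rcases lt_trichotomy t a with h | h | h
  · rw [max_eq_right h.le, ← hm]
    refine (hlin t).congr_of_eventuallyEq ?_
    filter_upwards [Iio_mem_nhds h] with x hx
    rw [hf, if_pos (le_of_lt hx)]
  · subst h
    rw [max_self]
    have h1 : HasDerivWithinAt f (p * t ^ (p - 1)) (Set.Iic t) t := by
      rw [← hm]
      refine (hlin t).hasDerivWithinAt.congr ?_ ?_
      · intro x hx
        rw [hf, if_pos (Set.mem_Iic.1 hx)]
      · rw [hf, if_pos le_rfl]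
    have h2 : HasDerivWithinAt f (p * t ^ (p - 1)) (Set.Ici t) t := by
      have h0 : f t = t ^ p := by rw [hf, if_pos le_rfl, hc]
      refine (hpow t ha).hasDerivWithinAt.congr ?_ h0
      intro x hx
      rcases eq_or_lt_of_le (Set.mem_Ici.1 hx) with h | h
      · rw [← h, h0]
      · rw [hf, if_neg (not_le.2 h)]
    have h3 := h1.union h2
    rwa [Set.Iic_union_Ici, hasDerivWithinAt_univ] at h3
  · rw [max_eq_left h.le]
    refine (hpow t (ha.trans h)).congr_of_eventuallyEq ?_
    filter_upwards [Ioi_mem_nhds h] with x hx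
    rw [hf, if_neg (not_le.2 hx)]

/-- For `β > 1`, `l ≥ 1` and the truncated functions `F_l`, `G_l`, the derivatives exist
at every `t > 0` and satisfy `G_l'(t)² = ((β-1)²/(4β)) |F_l'(t)|`. -/
theorem truncation_deriv_G_sq_eq_abs_deriv_F
    (β : ℝ) (hβ : 1 < β) (l : ℕ) (hl : 1 ≤ l)
    (F G : ℝ → ℝ)
    (hF : ∀ t : ℝ, F t = if t ≤ 1 / (l : ℝ)
        then -β * (l : ℝ) ^ (β + 1) * (t - (β + 1) / ((l : ℝ) * β))
        else t ^ (-β))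
    (hG : ∀ t : ℝ, G t = if t ≤ 1 / (l : ℝ)
        then (1 - β) / 2 * (l : ℝ) ^ ((β + 1) / 2) * (t + (β + 1) / ((l : ℝ) * (1 - β)))
        else t ^ ((1 - β) / 2)) :
    ∀ t : ℝ, 0 < t →
      DifferentiableAt ℝ F t ∧ DifferentiableAt ℝ G t ∧
      (deriv G t) ^ 2 = (β - 1) ^ 2 / (4 * β) * |deriv F t| := by
  intro t ht
  have hl0 : (0 : ℝ) < l := by exact_mod_cast hl
  have ha : (0 : ℝ) < 1 / (l : ℝ) := by positivity
  have hb : 1 - β ≠ 0 := by linarith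
  have hb0 : β ≠ 0 := by linarith
  have hinv : ∀ q : ℝ, (1 / (l : ℝ)) ^ q = (l : ℝ) ^ (-q) := by
    intro q
    rw [one_div, Real.inv_rpow hl0.le, Real.rpow_neg hl0.le]
  have dF := trunc_aux (-β) (1 / (l : ℝ)) (-β * (l : ℝ) ^ (β + 1)) (-((β + 1) / ((l : ℝ) * β)))
    ha F (by intro t; rw [hF t, sub_eq_add_neg])
    (by rw [hinv]; congr 2; ring)
    (by
      rw [hinv, neg_neg, Real.rpow_add_one hl0.ne']
      field_simp
      ring) t
  have dG := trunc_aux ((1 - β) / 2) (1 / (l : ℝ)) ((1 - β) / 2 * (l : ℝ) ^ ((β + 1) / 2))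
    ((β + 1) / ((l : ℝ) * (1 - β))) ha G hG
    (by rw [hinv]; congr 2; ring)
    (by
      rw [hinv, show (β + 1) / 2 = -((1 - β) / 2) + 1 by ring, Real.rpow_add_one hl0.ne']
      field_simp
      ring) t
  refine ⟨dF.differentiableAt, dG.differentiableAt, ?_⟩
  rw [dF.deriv, dG.deriv]
  have hM : 0 < max t (1 / (l : ℝ)) := lt_max_of_lt_left ht
  generalize max t (1 / (l : ℝ)) = M at hM
  have hp : 0 < M ^ (-β - 1) := Real.rpow_pos_of_pos hM _
  have hsq : (M ^ ((1 - β) / 2 - 1)) ^ 2 = M ^ (-β - 1) := by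
    rw [← Real.rpow_natCast, ← Real.rpow_mul hM.le]
    congr 1
    push_cast
    ring
  rw [mul_pow, hsq, abs_mul, abs_of_pos hp, abs_neg, abs_of_pos (by linarith : 0 < β)]
  field_simp
  ring
end

section
/- There exists a constant C = C(p,β) > 0, depending only on p and β and independent of l and of t, such that F_l(t)^p · |F_l'(t)|^{1−p} ≤ C · t^{p−β−1} for every t > 0. -/
open Set

theorem aux_bound (p β : ℝ) (hp : 2 ≤ p) (hβ : p - 1 < β) (s f : ℝ) (hs : 0 < s) (hf : 0 ≤ f)
    (hfs : f ≤ (β + 1) * s ^ β) :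
    f ^ p * (β * s ^ (β + 1)) ^ (1 - p) ≤ ((β + 1) ^ p * β ^ (1 - p)) * s ^ (β + 1 - p) := by
  have hb : 0 < β := by linarith
  have h1 : f ^ p ≤ ((β + 1) * s ^ β) ^ p := Real.rpow_le_rpow hf hfs (by linarith)
  have h2 : (0:ℝ) ≤ (β * s ^ (β + 1)) ^ (1 - p) := by positivity
  refine (mul_le_mul_of_nonneg_right h1 h2).trans (le_of_eq ?_)
  rw [Real.mul_rpow (by positivity) (by positivity), Real.mul_rpow (by positivity) (by positivity),
    ← Real.rpow_mul hs.le, ← Real.rpow_mul hs.le]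
  have h3 : s ^ (β + 1 - p) = s ^ (β * p) * s ^ ((β + 1) * (1 - p)) := by
    rw [← Real.rpow_add hs]; congr 1; ring
  rw [h3]; ring

/-- For `p ≥ 2` and `β > p-1`, there exists a constant `C = C(p,β) > 0`, independent of
`l` and `t`, such that `F_l(t)^p |F_l'(t)|^(1-p) ≤ C t^(p-β-1)` for every `t > 0`. -/
theorem truncation_F_energy_bound
    (p β : ℝ) (hp : 2 ≤ p) (hβ : p - 1 < β)
    (F F' : ℕ → ℝ → ℝ)
    (hF : ∀ l : ℕ, 1 ≤ l → ∀ t : ℝ, F l t = if t ≤ 1 / (l : ℝ)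
        then -β * (l : ℝ) ^ (β + 1) * (t - (β + 1) / ((l : ℝ) * β))
        else t ^ (-β))
    (hF' : ∀ l : ℕ, 1 ≤ l → ∀ t : ℝ, F' l t = if t < 1 / (l : ℝ)
        then -β * (l : ℝ) ^ (β + 1)
        else -β * t ^ (-β - 1)) :
    ∃ C : ℝ, 0 < C ∧ ∀ l : ℕ, 1 ≤ l → ∀ t : ℝ, 0 < t →
      F l t ^ p * |F' l t| ^ (1 - p) ≤ C * t ^ (p - β - 1) := by
  have hb : 0 < β := by linarith
  refine ⟨(β + 1) ^ p * β ^ (1 - p), by positivity, ?_⟩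
  intro l hl t ht
  have hl0 : (0:ℝ) < l := by exact_mod_cast hl
  rw [hF l hl t, hF' l hl t]
  have habs : ∀ x : ℝ, 0 < x → |-β * x| = β * x := by
    intro x hx
    rw [neg_mul, abs_neg, abs_of_pos (by positivity)]
  have hlb : (l:ℝ) ^ (β + 1) = (l:ℝ) ^ β * l := by
    rw [Real.rpow_add hl0, Real.rpow_one]
  have hval : -β * (l : ℝ) ^ (β + 1) * (t - (β + 1) / ((l : ℝ) * β))
      = (l:ℝ) ^ β * (β + 1 - β * (l * t)) := by
    rw [hlb]; field_simp; ring
  have hinv : ∀ x : ℝ, (t⁻¹) ^ x = t ^ (-x) := fun x => by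
    rw [Real.inv_rpow ht.le, Real.rpow_neg ht.le]
  have hpos : (0:ℝ) < (l:ℝ) ^ β := by positivity
  by_cases h : t < 1 / (l:ℝ)
  · rw [if_pos h.le, if_pos h, habs _ (by positivity), hval]
    have hlt : l * t < 1 := by rw [lt_div_iff₀ hl0] at h; linarith
    have hlt0 : 0 < l * t := by positivity
    refine (aux_bound p β hp hβ l _ hl0 (mul_nonneg hpos.le (by nlinarith)) ?_).trans ?_
    · nlinarith [mul_pos hpos (mul_pos hb hlt0)]
    · refine mul_le_mul_of_nonneg_left ?_ (by positivity)
      have : (l:ℝ) ≤ t⁻¹ := by rw [le_inv_comm₀ hl0 ht, ← one_div]; exact h.le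
      refine (Real.rpow_le_rpow hl0.le this (by linarith : 0 ≤ β + 1 - p)).trans (le_of_eq ?_)
      rw [hinv]; congr 1; ring
  · have hft : (if t ≤ 1 / (l : ℝ)
        then -β * (l : ℝ) ^ (β + 1) * (t - (β + 1) / ((l : ℝ) * β))
        else t ^ (-β)) = t⁻¹ ^ β := by
      split_ifs with h'
      · have he : t = 1 / (l:ℝ) := le_antisymm h' (not_lt.mp h)
        have he1 : (l:ℝ) * t = 1 := by rw [he]; field_simp
        have he2 : t⁻¹ = l := by rw [he]; simp
        rw [hval, he1, he2]; ring
      · rw [hinv]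
    rw [hft, if_neg h, habs _ (by positivity)]
    have hi : 0 < t⁻¹ := by positivity
    have hq : (0:ℝ) < t⁻¹ ^ β := by positivity
    have := aux_bound p β hp hβ t⁻¹ (t⁻¹ ^ β) hi hq.le (by nlinarith)
    rw [hinv (β + 1), hinv (β + 1 - p)] at this
    rw [show -β - 1 = -(β + 1) by ring, show p - β - 1 = -(β + 1 - p) by ring]
    exact this
end

section
/- There exists a constant C = C(p,β) > 0, depending only on p and β and independent of l and of t, such that G_l(t)^p · |G_l'(t)|^{2−p} ≤ C · t^{p−β−1} for every t > 0; moreover for t ≥ 1/l one has the exact identity G_l(t)^p |G_l'(t)|^{2−p} = ((β−1)/2)^{2−p} t^{p−β−1}. -/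
open Set

/-- For `p ≥ 2` and `β > p-1`, there exists a constant `C = C(p,β) > 0`, independent of
`l` and `t`, such that `G_l(t)^p |G_l'(t)|^(2-p) ≤ C t^(p-β-1)` for every `t > 0`;
moreover for `t ≥ 1/l` one has the exact identity
`G_l(t)^p |G_l'(t)|^(2-p) = ((β-1)/2)^(2-p) t^(p-β-1)`. -/
theorem truncation_G_energy_bound
    (p β : ℝ) (hp : 2 ≤ p) (hβ : p - 1 < β)
    (G G' : ℕ → ℝ → ℝ)
    (hG : ∀ l : ℕ, 1 ≤ l → ∀ t : ℝ, G l t = if t ≤ 1 / (l : ℝ)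
        then (1 - β) / 2 * (l : ℝ) ^ ((β + 1) / 2) * (t + (β + 1) / ((l : ℝ) * (1 - β)))
        else t ^ ((1 - β) / 2))
    (hG' : ∀ l : ℕ, 1 ≤ l → ∀ t : ℝ, G' l t = if t < 1 / (l : ℝ)
        then (1 - β) / 2 * (l : ℝ) ^ ((β + 1) / 2)
        else (1 - β) / 2 * t ^ (-(β + 1) / 2)) :
    (∃ C : ℝ, 0 < C ∧ ∀ l : ℕ, 1 ≤ l → ∀ t : ℝ, 0 < t →
      G l t ^ p * |G' l t| ^ (2 - p) ≤ C * t ^ (p - β - 1)) ∧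
    (∀ l : ℕ, 1 ≤ l → ∀ t : ℝ, 1 / (l : ℝ) ≤ t →
      G l t ^ p * |G' l t| ^ (2 - p) = ((β - 1) / 2) ^ (2 - p) * t ^ (p - β - 1)) := by
  have hb : 1 < β := by linarith
  have hb2 : 0 < (β - 1) / 2 := by linarith
  have key : ∀ l : ℕ, 1 ≤ l → ∀ t : ℝ, 1 / (l : ℝ) ≤ t →
      G l t ^ p * |G' l t| ^ (2 - p) = ((β - 1) / 2) ^ (2 - p) * t ^ (p - β - 1) := by
    intro l hl t ht
    have hL : (0 : ℝ) < l := by exact_mod_cast hl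
    have ht0 : 0 < t := lt_of_lt_of_le (by positivity) ht
    have h1 : G l t = t ^ ((1 - β) / 2) := by
      rw [hG l hl t]
      split_ifs with h
      · have hte : t = (l : ℝ)⁻¹ := by rw [← one_div]; exact le_antisymm h ht
        have e1 : t ^ ((1 - β) / 2) = (l : ℝ) ^ ((β - 1) / 2) := by
          rw [hte, Real.inv_rpow hL.le, ← Real.rpow_neg hL.le]
          congr 1; ring
        have e2 : (l : ℝ) ^ ((β + 1) / 2) = (l : ℝ) ^ ((β - 1) / 2) * l := by
          rw [← Real.rpow_add_one hL.ne']
          congr 1; ring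
        rw [e1, e2, hte]
        have : (1 - β) ≠ 0 := by linarith
        field_simp
        ring
      · rfl
    have h2 : |G' l t| = (β - 1) / 2 * t ^ (-(β + 1) / 2) := by
      rw [hG' l hl t, if_neg (not_lt.mpr ht), abs_mul, abs_of_pos (Real.rpow_pos_of_pos ht0 _),
        abs_of_neg (by linarith)]
      ring
    rw [h1, h2, Real.mul_rpow hb2.le (Real.rpow_nonneg ht0.le _), ← Real.rpow_mul ht0.le,
      ← Real.rpow_mul ht0.le, mul_left_comm, ← Real.rpow_add ht0]
    congr 2; ring
  refine ⟨⟨((β + 1) / 2) ^ p * ((β - 1) / 2) ^ (2 - p), by positivity, ?_⟩, key⟩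
  intro l hl t ht
  have hL : (0 : ℝ) < l := by exact_mod_cast hl
  rcases le_or_gt (1 / (l : ℝ)) t with h | h
  · rw [key l hl t h]
    have : 1 ≤ ((β + 1) / 2) ^ p := Real.one_le_rpow (by linarith) (by linarith)
    rw [mul_assoc]
    exact le_mul_of_one_le_left (by positivity) this
  · have e2 : (l : ℝ) ^ ((β + 1) / 2) = (l : ℝ) ^ ((β - 1) / 2) * l := by
      rw [← Real.rpow_add_one hL.ne']
      congr 1; ring
    have hlt : l * t < 1 := by rwa [lt_div_iff₀ hL, mul_comm] at h
    have h1 : G l t = (l : ℝ) ^ ((β - 1) / 2) * ((β + 1) / 2 - (β - 1) / 2 * (l * t)) := by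
      rw [hG l hl t, if_pos h.le, e2]
      have : (1 - β) ≠ 0 := by linarith
      field_simp
      ring
    have h2 : |G' l t| = (β - 1) / 2 * (l : ℝ) ^ ((β + 1) / 2) := by
      rw [hG' l hl t, if_pos h, abs_mul, abs_of_pos (Real.rpow_pos_of_pos hL _),
        abs_of_neg (by linarith)]
      ring
    have hlt0 : 0 < l * t := by positivity
    have h3 : 0 ≤ (β + 1) / 2 - (β - 1) / 2 * (l * t) := by nlinarith
    have h4 : (β + 1) / 2 - (β - 1) / 2 * (l * t) ≤ (β + 1) / 2 := by nlinarith
    have h5 : ((β + 1) / 2 - (β - 1) / 2 * (l * t)) ^ p ≤ ((β + 1) / 2) ^ p :=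
      Real.rpow_le_rpow h3 h4 (by linarith)
    have h6 : (l : ℝ) ^ (β + 1 - p) ≤ t ^ (p - β - 1) := by
      have : t ^ (p - β - 1) = (t⁻¹) ^ (β + 1 - p) := by
        rw [Real.inv_rpow ht.le, ← Real.rpow_neg ht.le]
        congr 1; ring
      rw [this]
      apply Real.rpow_le_rpow hL.le _ (by linarith)
      rw [← one_div, le_div_iff₀ ht]
      exact hlt.le
    have h7 : G l t ^ p * |G' l t| ^ (2 - p) =
        ((β + 1) / 2 - (β - 1) / 2 * (l * t)) ^ p * ((β - 1) / 2) ^ (2 - p)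
          * (l : ℝ) ^ (β + 1 - p) := by
      have e3 : (l : ℝ) ^ (β + 1 - p) =
          (l : ℝ) ^ ((β - 1) / 2 * p) * (l : ℝ) ^ ((β + 1) / 2 * (2 - p)) := by
        rw [← Real.rpow_add hL]
        congr 1; ring
      rw [h1, h2, Real.mul_rpow (Real.rpow_nonneg hL.le _) h3,
        Real.mul_rpow hb2.le (Real.rpow_nonneg hL.le _), ← Real.rpow_mul hL.le,
        ← Real.rpow_mul hL.le, e3]
      ring
    rw [h7]
    gcongr
end
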